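/- Let n > 3. For each m ≥ 3, let W(m) be the weighted orbit count of the ZMod 3 cyclic-shift action on triples of positive integers summing to m, and let W̃(m) be the weighted orbit count of the same action restricted to triples (a,b,c) with gcd(a,b,c) = 1 (weights being 1/(stabilizer order)). Then W(n) = Σ_{d ∣ n, d > 1} W̃(d), where W̃(d) is interpreted as 0 for d < 3. -/

import Mathlib

/-- Triples of positive integers summing to `m`, indexed by `ZMod 3`. -/
def Triples (m : ℕ) : Type :=
  {v : ZMod 3 → ℕ // (∀ i, 0 < v i) ∧ ∑ i, v i = m}

/-- Triples of positive integers summing to `m` with `gcd = 1`. -/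
def PrimTriples (m : ℕ) : Type :=
  {v : ZMod 3 → ℕ // ((∀ i, 0 < v i) ∧ ∑ i, v i = m) ∧ Finset.univ.gcd v = 1}

lemma gcd_shift (v : ZMod 3 → ℕ) (a : ZMod 3) :
    Finset.univ.gcd (fun i => v (i + a)) = Finset.univ.gcd v := by
  apply Nat.dvd_antisymm
  · refine Finset.dvd_gcd fun j _ => ?_
    simpa using Finset.gcd_dvd (f := fun i => v (i + a)) (Finset.mem_univ (j - a))
  · refine Finset.dvd_gcd fun j _ => ?_
    exact Finset.gcd_dvd (Finset.mem_univ (j + a))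

/-- The action of `ZMod 3` (written multiplicatively) on triples by cyclic shifts. -/
instance shiftAction (m : ℕ) : MulAction (Multiplicative (ZMod 3)) (Triples m) where
  smul g v := ⟨fun i => v.1 (i + g.toAdd),
    fun i => v.2.1 _,
    (Equiv.sum_comp (Equiv.addRight g.toAdd) v.1).trans v.2.2⟩
  one_smul v := Subtype.ext <| funext fun i => by simp [HSMul.hSMul]
  mul_smul g h v := Subtype.ext <| funext fun i => by
    simp [HSMul.hSMul, add_comm, add_left_comm, add_assoc]

/-- The cyclic shift action restricted to primitive triples. -/
instance primShiftAction (m : ℕ) :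
    MulAction (Multiplicative (ZMod 3)) (PrimTriples m) where
  smul g v := ⟨fun i => v.1 (i + g.toAdd),
    ⟨fun i => v.2.1.1 _,
      (Equiv.sum_comp (Equiv.addRight g.toAdd) v.1).trans v.2.1.2⟩,
    (gcd_shift v.1 g.toAdd).trans v.2.2⟩
  one_smul v := Subtype.ext <| funext fun i => by simp [HSMul.hSMul]
  mul_smul g h v := Subtype.ext <| funext fun i => by
    simp [HSMul.hSMul, add_comm, add_left_comm, add_assoc]

/-- `W m` : the weighted orbit count of the cyclic shift action on triples of positive
integers summing to `m`, each orbit weighted by `1/(stabilizer order)`. -/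
noncomputable def W (m : ℕ) : ℚ :=
  ∑ᶠ ω : MulAction.orbitRel.Quotient (Multiplicative (ZMod 3)) (Triples m),
    (1 : ℚ) / Nat.card (MulAction.stabilizer (Multiplicative (ZMod 3)) (Quotient.out ω))

/-- `Wtilde m` : the weighted orbit count of the cyclic shift action on triples of
positive integers summing to `m` with `gcd = 1`.  (For `m < 3` there are no such
triples, so the count is `0`.) -/
noncomputable def Wtilde (m : ℕ) : ℚ :=
  ∑ᶠ ω : MulAction.orbitRel.Quotient (Multiplicative (ZMod 3)) (PrimTriples m),
    (1 : ℚ) / Nat.card (MulAction.stabilizer (Multiplicative (ZMod 3)) (Quotient.out ω))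

lemma finsum_one_div_card_stabilizer (G X : Type*) [Group G] [MulAction G X] [Finite G]
    [Finite X] :
    ∑ᶠ ω : MulAction.orbitRel.Quotient G X,
      (1 : ℚ) / Nat.card (MulAction.stabilizer G (Quotient.out ω)) =
      Nat.card X / Nat.card G := by
  classical
  have : Fintype (MulAction.orbitRel.Quotient G X) := Fintype.ofFinite _
  rw [finsum_eq_sum_of_fintype, Nat.card_congr (MulAction.selfEquivSigmaOrbits G X),
    Nat.card_sigma, Nat.cast_sum, Finset.sum_div]
  refine Finset.sum_congr rfl fun ω _ => ?_
  have hG : (Nat.card G : ℚ) ≠ 0 := Nat.cast_ne_zero.2 Nat.card_pos.ne'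
  have hs : (Nat.card (MulAction.stabilizer G (Quotient.out ω)) : ℚ) ≠ 0 :=
    Nat.cast_ne_zero.2 Nat.card_pos.ne'
  rw [div_eq_div_iff hs hG, one_mul, ← Nat.cast_mul,
    ← Nat.card_prod, Nat.card_congr (MulAction.orbitProdStabilizerEquivGroup G (Quotient.out ω))]

instance finite_triples (m : ℕ) : Finite (Triples m) := by
  refine Finite.of_injective
    (fun (v : Triples m) (i : ZMod 3) => (⟨v.1 i, Nat.lt_succ_of_le ?_⟩ : Fin (m + 1))) ?_
  · exact (Finset.single_le_sum (fun _ _ => Nat.zero_le _) (Finset.mem_univ i)).trans v.2.2.le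
  · intro v w h
    exact Subtype.ext <| funext fun i => congrArg Fin.val (congrFun h i)

instance finite_primTriples (m : ℕ) : Finite (PrimTriples m) :=
  Finite.of_injective (β := Triples m) (fun v => ⟨v.1, v.2.1⟩) fun _ _ h =>
    Subtype.ext (congrArg (fun v : Triples m => v.1) h)

/-- Multiplication of a primitive triple with sum `d ∣ n` by `n / d`. -/
def scaleTriple (n : ℕ) (hn : 0 < n)
    (p : Σ d : {d // d ∈ n.divisors.filter (fun d => 1 < d)}, PrimTriples d) : Triples n :=
  ⟨fun i => n / p.1.1 * p.2.1 i, by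
    have hd : p.1.1 ∣ n := Nat.dvd_of_mem_divisors (Finset.mem_filter.1 p.1.2).1
    refine ⟨fun i => Nat.mul_pos (Nat.div_pos (Nat.le_of_dvd hn hd)
      (Nat.pos_of_dvd_of_pos hd hn)) (p.2.2.1.1 i), ?_⟩
    rw [← Finset.mul_sum, p.2.2.1.2, Nat.div_mul_cancel hd]⟩

lemma gcd_scaleTriple (n : ℕ) (hn : 0 < n)
    (p : Σ d : {d // d ∈ n.divisors.filter (fun d => 1 < d)}, PrimTriples d) :
    Finset.univ.gcd (scaleTriple n hn p).1 = n / p.1.1 := by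
  simp [scaleTriple, Finset.gcd_mul_left, p.2.2.2]

lemma scaleTriple_injective (n : ℕ) (hn : 0 < n) : Function.Injective (scaleTriple n hn) := by
  intro p q h
  have hg : n / p.1.1 = n / q.1.1 := by
    rw [← gcd_scaleTriple n hn, ← gcd_scaleTriple n hn, h]
  have hp : p.1.1 ∣ n := Nat.dvd_of_mem_divisors (Finset.mem_filter.1 p.1.2).1
  have hq : q.1.1 ∣ n := Nat.dvd_of_mem_divisors (Finset.mem_filter.1 q.1.2).1
  have hd : p.1 = q.1 := Subtype.ext <| by
    rw [← Nat.div_div_self hp hn.ne', hg, Nat.div_div_self hq hn.ne']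
  obtain ⟨d, v⟩ := p
  obtain ⟨d', w⟩ := q
  obtain rfl : d = d' := hd
  congr 1
  refine Subtype.ext <| funext fun i => ?_
  exact Nat.eq_of_mul_eq_mul_left
    (Nat.div_pos (Nat.le_of_dvd hn hp) (Nat.pos_of_dvd_of_pos hp hn))
    (congrFun (congrArg Subtype.val h) i)

lemma scaleTriple_surjective (n : ℕ) (hn : 0 < n) :
    Function.Surjective (scaleTriple n hn) := by
  intro v
  obtain ⟨w, hw, hw1⟩ := Finset.extract_gcd v.1 (Finset.univ_nonempty (α := ZMod 3))
  have hvw : ∀ i, v.1 i = Finset.univ.gcd v.1 * w i := fun i => hw i (Finset.mem_univ i)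
  have hpos : ∀ i, 0 < w i := fun i => by
    have := v.2.1 i
    rw [hvw i] at this
    exact Nat.pos_of_mul_pos_left this
  have hn' : n = Finset.univ.gcd v.1 * ∑ i, w i := by
    rw [Finset.mul_sum]
    exact v.2.2.symm.trans (Finset.sum_congr rfl fun i _ => hvw i)
  have hlt : 1 < ∑ i, w i :=
    calc 1 < ∑ _i : ZMod 3, 1 := by simp
      _ ≤ ∑ i, w i := Finset.sum_le_sum fun i _ => hpos i
  have hmem : ∑ i, w i ∈ n.divisors.filter (fun d => 1 < d) :=
    Finset.mem_filter.2 ⟨Nat.mem_divisors.2 ⟨⟨_, hn'.trans (mul_comm _ _)⟩, hn.ne'⟩, hlt⟩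
  refine ⟨⟨⟨_, hmem⟩, ⟨w, ⟨hpos, rfl⟩, hw1⟩⟩, Subtype.ext <| funext fun i => ?_⟩
  rw [hvw i]
  exact congrArg (· * w i) (Nat.div_eq_of_eq_mul_left (zero_lt_one.trans hlt) hn')

lemma card_triples_eq_sum (n : ℕ) (hn : 0 < n) :
    Nat.card (Triples n) =
      ∑ d ∈ n.divisors.filter (fun d => 1 < d), Nat.card (PrimTriples d) := by
  rw [← Nat.card_eq_of_bijective _ ⟨scaleTriple_injective n hn, scaleTriple_surjective n hn⟩,
    Nat.card_sigma]
  exact Finset.sum_coe_sort _ fun d => Nat.card (PrimTriples d)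

/-- `W(n) = Σ_{d ∣ n, d > 1} W̃(d)`. -/
theorem weighted_count_eq_sum_primitive (n : ℕ) (hn : 3 < n) :
    W n = ∑ d ∈ n.divisors.filter (fun d => 1 < d), Wtilde d := by
  simp only [W, Wtilde, finsum_one_div_card_stabilizer]
  rw [card_triples_eq_sum n (by omega), Nat.cast_sum, Finset.sum_div]
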